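/- With μ̃ = 2√μ/(μ+1) and μ̆ = (1/2)(μ+1) μ̃^{2/(μ+1)}, the increments Δλ_j satisfy Δλ_j = μ̆ n^{−2β} ρ^{2/(μ+1)} λ_{j−1}^{(μ−1)/(μ+1)} (1 + o(1)) uniformly on the trading range, i.e. lim_{n→∞} sup_{m₁ ≤ j ≤ m₂} | Δλ_j / ( μ̆ n^{−2β} ρ^{2/(μ+1)} λ_{j−1}^{(μ−1)/(μ+1)} ) − 1 | = 0. -/

import Mathlib

/-- λ₀ = ρ √n · 2√μ/(μ+1). -/
noncomputable def lam0 (μ ρ : ℝ) (n : ℕ) : ℝ :=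
  ρ * Real.sqrt n * (2 * Real.sqrt μ / (μ + 1))

/-- Trading times t_j = 1 − (1 − j/n)^μ. -/
noncomputable def tradeT (μ : ℝ) (n j : ℕ) : ℝ :=
  1 - (1 - (j : ℝ) / n) ^ μ

/-- λ_j = λ₀ (1 − j/n)^{(μ+1)/2}. -/
noncomputable def lamJ (μ ρ : ℝ) (n j : ℕ) : ℝ :=
  lam0 μ ρ n * (1 - (j : ℝ) / n) ^ ((μ + 1) / 2)

/-- Δλ_j = λ_{j−1} − λ_j. -/
noncomputable def dLam (μ ρ : ℝ) (n j : ℕ) : ℝ :=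
  lamJ μ ρ n (j - 1) - lamJ μ ρ n j

/-- Δt_j = t_j − t_{j−1}. -/
noncomputable def dT (μ : ℝ) (n j : ℕ) : ℝ :=
  tradeT μ n j - tradeT μ n (j - 1)

/-- l_* = (log n)^{−3}. -/
noncomputable def lStar (n : ℕ) : ℝ := ((Real.log n) ^ (3 : ℕ))⁻¹

/-- l^* = (log n)^3. -/
noncomputable def lUpStar (n : ℕ) : ℝ := (Real.log n) ^ (3 : ℕ)

/-- m₁ = n − ⌊n (l^*/λ₀)^{2/(μ+1)}⌋. -/
noncomputable def mLow (μ ρ : ℝ) (n : ℕ) : ℕ :=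
  n - ⌊(n : ℝ) * (lUpStar n / lam0 μ ρ n) ^ ((2 : ℝ) / (μ + 1))⌋₊

/-- m₂ = n − ⌊n (l_*/λ₀)^{2/(μ+1)}⌋. -/
noncomputable def mUp (μ ρ : ℝ) (n : ℕ) : ℕ :=
  n - ⌊(n : ℝ) * (lStar n / lam0 μ ρ n) ^ ((2 : ℝ) / (μ + 1))⌋₊

open Filter Topology

lemma aux_ratio (a : ℝ) (ha : 1 ≤ a) (ε : ℝ) (hε : 0 < ε) :
    ∃ δ : ℝ, 0 < δ ∧ ∀ u : ℝ, 0 < u → u < δ → |(1 - (1 - u) ^ a) / (a * u) - 1| < ε := by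
  have h1 : HasDerivAt (fun u : ℝ => (1 - u) ^ a) (-a) 0 := by
    have h := ((hasDerivAt_id (0 : ℝ)).const_sub 1).rpow_const (p := a) (Or.inr ha)
    simpa using h
  have h2 := hasDerivAt_iff_tendsto_slope.1 h1
  rw [Metric.tendsto_nhdsWithin_nhds] at h2
  obtain ⟨δ, hδ, h⟩ := h2 ε hε
  refine ⟨δ, hδ, fun u hu hud => ?_⟩
  have h3 := h (x := u) (by simpa using hu.ne') (by simpa [abs_of_pos hu] using hud)
  have ha0 : 0 < a := by linarith
  have e : (1 - (1 - u) ^ a) / (a * u) - 1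
      = -(slope (fun u : ℝ => (1 - u) ^ a) 0 u - (-a)) / a := by
    simp only [slope_def_field, sub_zero, Real.one_rpow]
    field_simp
    ring
  rw [Real.dist_eq] at h3
  rw [e, abs_div, abs_neg, abs_of_pos ha0]
  exact lt_of_le_of_lt (div_le_self (abs_nonneg _) ha) h3

lemma aux_z : Tendsto (fun n : ℕ => (Real.log n) ^ (3 : ℕ) / Real.sqrt n) atTop (𝓝 0) := by
  have h := (isLittleO_log_rpow_rpow_atTop (3 : ℝ) (s := 1 / 2) (by norm_num)).tendsto_div_nhds_zero
  have h' := h.comp (tendsto_natCast_atTop_atTop (R := ℝ))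
  refine h'.congr fun n => ?_
  simp only [Function.comp, Real.sqrt_eq_rpow]
  norm_cast

lemma aux_den (a n x : ℝ) (ha : 1 ≤ a) (r m : ℝ) (hr : 0 < r) (hm : 0 < m) (hn : 0 < n)
    (hx : 0 < x) :
    a * m ^ (1 / a) * n ^ (-((2 * a - 1) / (2 * a))) * r ^ (1 / a)
      * (r * Real.sqrt n * m * x ^ a) ^ ((a - 1) / a)
      = a * (r * Real.sqrt n * m) * x ^ a / (n * x) := by
  have ha0 : 0 < a := by linarith
  rw [Real.mul_rpow (by positivity) (by positivity), Real.mul_rpow (by positivity) (by positivity),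
    Real.mul_rpow (by positivity) (by positivity), ← Real.rpow_mul hx.le, Real.sqrt_eq_rpow,
    ← Real.rpow_mul hn.le]
  have e1 : r ^ (1 / a) * r ^ ((a - 1) / a) = r := by
    rw [← Real.rpow_add hr]; convert Real.rpow_one r using 2; field_simp; ring
  have e2 : m ^ (1 / a) * m ^ ((a - 1) / a) = m := by
    rw [← Real.rpow_add hm]; convert Real.rpow_one m using 2; field_simp; ring
  have e3 : n ^ (-((2 * a - 1) / (2 * a))) * n ^ (1 / 2 * ((a - 1) / a)) = n ^ (1 / 2 : ℝ) / n := by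
    rw [← Real.rpow_add hn, ← Real.rpow_sub_one hn.ne']; congr 1; field_simp; ring
  have e4 : x ^ (a * ((a - 1) / a)) = x ^ a / x := by
    rw [← Real.rpow_sub_one hx.ne']; congr 1; field_simp
  rw [e4]
  calc _ = a * (m ^ (1 / a) * m ^ ((a - 1) / a)) * (r ^ (1 / a) * r ^ ((a - 1) / a))
        * (n ^ (-((2 * a - 1) / (2 * a))) * n ^ (1 / 2 * ((a - 1) / a))) * (x ^ a / x) := by ring
    _ = _ := by rw [e1, e2, e3]; field_simp

/- STATEMENT 3: With μ̃ = 2√μ/(μ+1) and μ̆ = (1/2)(μ+1) μ̃^{2/(μ+1)},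
   Δλ_j = μ̆ n^{−2β} ρ^{2/(μ+1)} λ_{j−1}^{(μ−1)/(μ+1)} (1 + o(1)) uniformly over
   the trading range m₁ ≤ j ≤ m₂. -/
theorem dLam_asymptotics (μ ρ : ℝ) (hμ1 : 1 ≤ μ) (hμ2 : μ < 2) (hρ : 0 < ρ) :
    ∀ ε : ℝ, 0 < ε → ∃ N : ℕ, ∀ n : ℕ, N ≤ n → ∀ j : ℕ,
      mLow μ ρ n ≤ j → j ≤ mUp μ ρ n →
        |dLam μ ρ n j /
            ((1 / 2) * (μ + 1) * (2 * Real.sqrt μ / (μ + 1)) ^ ((2 : ℝ) / (μ + 1))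
              * (n : ℝ) ^ (-(2 * (μ / (2 * (μ + 1))))) * ρ ^ ((2 : ℝ) / (μ + 1))
              * lamJ μ ρ n (j - 1) ^ ((μ - 1) / (μ + 1))) - 1| < ε := by
  intro ε hε
  have ha : 1 ≤ (μ + 1) / 2 := by linarith
  obtain ⟨δ, hδ, hR⟩ := aux_ratio ((μ + 1) / 2) ha ε hε
  have hm : 0 < 2 * Real.sqrt μ / (μ + 1) := by
    have : 0 < Real.sqrt μ := Real.sqrt_pos.2 (by linarith)
    have : 0 < μ + 1 := by linarith
    positivity
  obtain ⟨K, hK⟩ := exists_nat_gt (1 / δ)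
  set m := 2 * Real.sqrt μ / (μ + 1) with hmdef
  have hC : 0 < ρ * m := by positivity
  have ev1 := aux_z.eventually (gt_mem_nhds hC)
  have ev2 := aux_z.eventually (gt_mem_nhds (show (0:ℝ) < 1 / (ρ * m * (K + 1)) by positivity))
  have ev3 := (Real.tendsto_log_atTop.comp (tendsto_natCast_atTop_atTop (R := ℝ))).eventually
    (eventually_ge_atTop 1)
  obtain ⟨N, hN⟩ := eventually_atTop.1 ((ev1.and ev2).and (ev3.and (eventually_ge_atTop 2)))
  refine ⟨N, fun n hn j hj1 hj2 => ?_⟩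
  obtain ⟨⟨h1, h2⟩, h3, h4⟩ := hN n hn
  simp only [Function.comp] at h3
  have hn0 : (0 : ℝ) < n := by exact_mod_cast (by omega : 0 < n)
  have hs : 0 < Real.sqrt n := Real.sqrt_pos.2 hn0
  have hss : Real.sqrt n * Real.sqrt n = n := Real.mul_self_sqrt hn0.le
  have hL : 1 ≤ Real.log n ^ 3 := one_le_pow₀ h3
  have hL0 : 0 < Real.log n ^ 3 := by linarith
  have hl0 : 0 < lam0 μ ρ n := by unfold lam0; rw [← hmdef]; positivity
  have hl : lam0 μ ρ n = ρ * Real.sqrt n * m := rfl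
  have hp : 0 < (2 : ℝ) / (μ + 1) := by
    have : 0 < μ + 1 := by linarith
    positivity
  have hp1 : (2 : ℝ) / (μ + 1) ≤ 1 := by
    rw [div_le_one (by linarith)]; linarith
  have hup : lUpStar n / lam0 μ ρ n < 1 := by
    rw [div_lt_one hl0, hl]; unfold lUpStar
    rw [div_lt_iff₀ hs] at h1; linarith
  have hup0 : 0 < lUpStar n / lam0 μ ρ n := div_pos hL0 hl0
  have hlo0 : 0 < lStar n / lam0 μ ρ n := div_pos (inv_pos.2 hL0) hl0
  have hlo : lStar n / lam0 μ ρ n < 1 := by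
    refine lt_of_le_of_lt ?_ hup
    unfold lStar lUpStar
    gcongr
    exact (inv_le_one_of_one_le₀ hL).trans hL
  -- `j` is positive
  have hj0 : 1 ≤ j := by
    refine le_trans ?_ hj1
    unfold mLow
    have : ⌊(n : ℝ) * (lUpStar n / lam0 μ ρ n) ^ ((2 : ℝ) / (μ + 1))⌋₊ < n := by
      rw [Nat.floor_lt (by positivity)]
      have := Real.rpow_lt_one hup0.le hup hp
      nlinarith
    omega
  -- `n - j` is large
  have hjK : j + K ≤ n := by
    unfold mUp at hj2
    have f1 : ⌊(n : ℝ) * (lStar n / lam0 μ ρ n) ^ ((2 : ℝ) / (μ + 1))⌋₊ < n := by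
      rw [Nat.floor_lt (by positivity)]
      have := Real.rpow_lt_one hlo0.le hlo hp
      nlinarith
    have f2 : K ≤ ⌊(n : ℝ) * (lStar n / lam0 μ ρ n) ^ ((2 : ℝ) / (μ + 1))⌋₊ := by
      apply Nat.le_floor
      have g1 : lStar n / lam0 μ ρ n ≤ (lStar n / lam0 μ ρ n) ^ ((2 : ℝ) / (μ + 1)) := by
        simpa using Real.rpow_le_rpow_of_exponent_ge hlo0 hlo.le hp1
      have g2 : (K : ℝ) ≤ n * (lStar n / lam0 μ ρ n) := by
        have g3 : (n : ℝ) * (lStar n / lam0 μ ρ n) = Real.sqrt n / (Real.log n ^ 3 * (ρ * m)) := by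
          rw [hl]; unfold lStar
          nth_rewrite 1 [← hss]
          field_simp
        rw [g3, le_div_iff₀ (by positivity)]
        rw [div_lt_div_iff₀ hs (by positivity)] at h2
        have : 0 < Real.log n ^ 3 * (ρ * m) := by positivity
        nlinarith
      exact g2.trans (by gcongr)
    omega
  obtain ⟨i, rfl⟩ : ∃ i, j = i + 1 := ⟨j - 1, by omega⟩
  have hjKr : (i : ℝ) + 1 + K ≤ n := by exact_mod_cast hjK
  have hK0 : 0 < (K : ℝ) := lt_trans (by positivity) hK
  have hx : 0 < 1 - (i : ℝ) / n := by
    rw [sub_pos, div_lt_one hn0]; linarith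
  set x := 1 - (i : ℝ) / n with hxdef
  have hnx : (n : ℝ) * x = n - i := by rw [hxdef]; field_simp
  have hu : 0 < 1 / ((n : ℝ) * x) := by positivity
  have hud : 1 / ((n : ℝ) * x) < δ := by
    rw [div_lt_comm₀ (by positivity) hδ, hnx]; linarith
  have hfin := hR _ hu hud
  have hden := aux_den ((μ + 1) / 2) n x ha ρ m hρ hm hn0 hx
  have q1 : (1 : ℝ) / ((μ + 1) / 2) = 2 / (μ + 1) := by rw [one_div_div]
  have q2 : (2 * ((μ + 1) / 2) - 1) / (2 * ((μ + 1) / 2)) = 2 * (μ / (2 * (μ + 1))) := by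
    have : μ + 1 ≠ 0 := by linarith
    field_simp; ring
  have q3 : ((μ + 1) / 2 - 1) / ((μ + 1) / 2) = (μ - 1) / (μ + 1) := by
    have : μ + 1 ≠ 0 := by linarith
    field_simp; ring
  rw [q1, q2, q3] at hden
  have hlam : lamJ μ ρ n i = ρ * Real.sqrt n * m * x ^ ((μ + 1) / 2) := rfl
  have hstep : 1 - ((i + 1 : ℕ) : ℝ) / n = x * (1 - 1 / (n * x)) := by
    have hx' := hx.ne'
    have hi : (i : ℝ) = n * (1 - x) := by linarith
    push_cast
    rw [hi]
    clear_value x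
    field_simp
    ring
  have hle : 0 ≤ 1 - 1 / ((n : ℝ) * x) := by
    rw [sub_nonneg, div_le_one (by positivity), hnx]
    have : (1 : ℝ) ≤ K := by exact_mod_cast (by exact_mod_cast hK0 : 0 < K)
    linarith
  have hlam2 : lamJ μ ρ n (i + 1) =
      ρ * Real.sqrt n * m * (x ^ ((μ + 1) / 2) * (1 - 1 / (n * x)) ^ ((μ + 1) / 2)) := by
    unfold lamJ
    rw [hstep, Real.mul_rpow hx.le hle, hl]
  have hxa : 0 < x ^ ((μ + 1) / 2) := Real.rpow_pos_of_pos hx _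
  unfold dLam
  rw [Nat.add_sub_cancel, hlam2, hlam, show (1 : ℝ) / 2 * (μ + 1) = (μ + 1) / 2 by ring, hden]
  convert hfin using 3
  have : μ + 1 ≠ 0 := by linarith
  generalize (1 - 1 / ((n : ℝ) * x)) ^ ((μ + 1) / 2) = w
  generalize x ^ ((μ + 1) / 2) = v at *
  have := hxa.ne'
  field_simp
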